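/- arXiv:2507.08965 — 2 statements merged into one kernel-verified Lean document; each statement's English description precedes it below -/
import Mathlib

section
/- Let 0 < δ = t_0 < t_1 < ⋯ < t_k = T be a time partition, let w_0, …, w_{k−1} ∈ ℝ be guidance strengths, and let ρ : ℝ → (Fin M → ℝ) be continuous on [δ, T] and, for each i, a reverse-dynamics solution for the column-normalized family (R_nor^{(w_i)}_τ) on (t_i, t_{i+1}). Then: (1) for every i, ρ t_i m = ρ t_{i+1} m · (1 − exp(−σ̄ t_i))/(1 − exp(−σ̄ t_{i+1})); and (2) for every j ≠ m, ρ δ j = ρ T j + ∑_{i=0}^{k−1} ρ t_{i+1} m · (1 − (1 − exp(−σ̄ t_i))/(1 − exp(−σ̄ t_{i+1}))) · p^{(w_i)} j. In particular, under column normalization the unmasking rate is independent of the guidance strengths. -/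
open Finset

noncomputable section GuidedMaskedDiffusion1D

variable {M : ℕ}

/-- Partition function `Z_w = ∑_{i ≠ m} (p i)^w (q i)^{1-w}`. -/
def Zw (m : Fin M) (p q : Fin M → ℝ) (w : ℝ) : ℝ :=
  ∑ i ∈ Finset.univ.filter (fun i => i ≠ m), (p i) ^ w * (q i) ^ (1 - w)

/-- Tilted distribution `p^{(w)} i = (p i)^w (q i)^{1-w} / Z_w` for `i ≠ m`, and
`p^{(w)} m = 0`. -/
def tilted (m : Fin M) (p q : Fin M → ℝ) (w : ℝ) : Fin M → ℝ :=
  fun i => if i = m then 0 else (p i) ^ w * (q i) ^ (1 - w) / Zw m p q w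

/-- Integrated noise schedule `σ̄ t = ∫_0^t σ`. -/
def sigmaBar (σ : ℝ → ℝ) (t : ℝ) : ℝ := ∫ s in (0 : ℝ)..t, σ s

/-- `c t = σ t · exp(-σ̄ t) / (1 - exp(-σ̄ t))`. -/
def cFun (σ : ℝ → ℝ) (t : ℝ) : ℝ :=
  σ t * Real.exp (-(sigmaBar σ t)) / (1 - Real.exp (-(sigmaBar σ t)))

/-- The matrix `A_w`: its column indexed by `m` has entries `(A_w) i m = p^{(w)} i` for
`i ≠ m` and `(A_w) m m = -1`; all other columns vanish. -/
def Amat (m : Fin M) (p q : Fin M → ℝ) (w : ℝ) : Matrix (Fin M) (Fin M) ℝ :=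
  fun i j => if j = m then (if i = m then -1 else tilted m p q w i) else 0

/-- The (unnormalized) guided rate matrix `R^{(w)}_t = (c t · Z_w) • A_w`. -/
def guidedRate (m : Fin M) (p q : Fin M → ℝ) (σ : ℝ → ℝ) (w t : ℝ) :
    Matrix (Fin M) (Fin M) ℝ :=
  (cFun σ t * Zw m p q w) • Amat m p q w

/-- The column-normalized guided rate matrix `R_nor^{(w)}_t = (c t) • A_w`. -/
def guidedRateNor (m : Fin M) (p q : Fin M → ℝ) (σ : ℝ → ℝ) (w t : ℝ) :
    Matrix (Fin M) (Fin M) ℝ :=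
  cFun σ t • Amat m p q w

/-- A reverse-dynamics solution for a family of rate matrices `Rfam` on an interval `I`:
a continuous `ρ` such that, at every `s` in the interior of `I`, `ρ` has derivative
`-(Rfam s).mulVec (ρ s)` at `s`. -/
def IsReverseSol (Rfam : ℝ → Matrix (Fin M) (Fin M) ℝ) (I : Set ℝ)
    (ρ : ℝ → Fin M → ℝ) : Prop :=
  ContinuousOn ρ I ∧ ∀ s ∈ interior I, HasDerivAt ρ (-((Rfam s).mulVec (ρ s))) s

end GuidedMaskedDiffusion1D

theorem aux_const (f : ℝ → ℝ) (a b : ℝ) (hab : a < b) (hf : ContinuousOn f (Set.Icc a b))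
    (hd : ∀ x ∈ Set.Ioo a b, HasDerivAt f 0 x) : f a = f b := by
  obtain ⟨c, hc, h⟩ := exists_hasDerivAt_eq_slope f (fun _ => 0) hab hf hd
  have : b - a ≠ 0 := by linarith
  field_simp at h
  linarith

theorem aux_mulVec {M : ℕ} (m : Fin M) (p q : Fin M → ℝ) (σ : ℝ → ℝ) (w t : ℝ)
    (v : Fin M → ℝ) (j : Fin M) :
    (guidedRateNor m p q σ w t).mulVec v j
      = cFun σ t * (if j = m then -1 else tilted m p q w j) * v m := by
  simp [guidedRateNor, Amat, Matrix.mulVec, dotProduct]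

theorem aux_sum (k : ℕ) (f : Fin (k + 1) → ℝ) (g : Fin k → ℝ)
    (h : ∀ i : Fin k, f i.castSucc = f i.succ + g i) : f 0 = f (Fin.last k) + ∑ i, g i := by
  induction k with
  | zero => simp
  | succ n ih =>
    have h1 := ih (fun i => f i.castSucc) (fun i => g i.castSucc) (fun i => h i.castSucc)
    have h2 := h (Fin.last n)
    rw [Fin.sum_univ_castSucc]
    simp only [Fin.castSucc_zero, Fin.succ_last] at h1 h2
    linarith

theorem aux_sb (σ : ℝ → ℝ) (hσ : Continuous σ) (t : ℝ) :
    HasDerivAt (fun t => 1 - Real.exp (-(sigmaBar σ t)))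
      (σ t * Real.exp (-(sigmaBar σ t))) t := by
  have h : HasDerivAt (sigmaBar σ) (σ t) t :=
    intervalIntegral.integral_hasDerivAt_right (hσ.intervalIntegrable _ _)
      (hσ.stronglyMeasurableAtFilter _ _) hσ.continuousAt
  have := (h.neg.exp).const_sub 1
  refine this.congr_deriv ?_
  simp only [Pi.neg_apply]
  ring

theorem aux_pos (σ : ℝ → ℝ) (hσ : Continuous σ) (hσpos : ∀ t, 0 < t → 0 < σ t) (t : ℝ)
    (ht : 0 < t) : 0 < 1 - Real.exp (-(sigmaBar σ t)) := by
  have : 0 < sigmaBar σ t :=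
    intervalIntegral.intervalIntegral_pos_of_pos_on (hσ.intervalIntegrable _ _)
      (fun x hx => hσpos x hx.1) ht
  have : Real.exp (-(sigmaBar σ t)) < 1 := by rw [Real.exp_lt_one_iff]; linarith
  linarith

/-- Let `0 < δ = t_0 < t_1 < ⋯ < t_k = T` be a time partition, let
`w_0, …, w_{k-1}` be guidance strengths, and let `ρ` be continuous on `[δ, T]` and, for each
`i`, a reverse-dynamics solution for the column-normalized family `(R_nor^{(w_i)}_τ)` on
`(t_i, t_{i+1})`.  Then: (1) for every `i`,
`ρ t_i m = ρ t_{i+1} m · (1 - exp(-σ̄ t_i))/(1 - exp(-σ̄ t_{i+1}))`; and (2) for every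
`j ≠ m`,
`ρ δ j = ρ T j + ∑_i ρ t_{i+1} m · (1 - (1 - exp(-σ̄ t_i))/(1 - exp(-σ̄ t_{i+1}))) · p^{(w_i)} j`.
In particular, under column normalization the unmasking rate is independent of the guidance
strengths. -/
theorem guided_reverse_dynamics_piecewise_constant_normalized
    (M : ℕ) (hM : 2 ≤ M) (m : Fin M) (hm : (m : ℕ) = M - 1)
    (p q : Fin M → ℝ)
    (hp_nonneg : ∀ i, 0 ≤ p i) (hp_sum : ∑ i, p i = 1) (hpm : p m = 0)
    (hp_pos : ∀ i, i ≠ m → 0 < p i)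
    (hq_nonneg : ∀ i, 0 ≤ q i) (hq_sum : ∑ i, q i = 1) (hqm : q m = 0)
    (hq_pos : ∀ i, i ≠ m → 0 < q i)
    (T : ℝ) (hT : 0 < T)
    (σ : ℝ → ℝ) (hσ : Continuous σ) (hσpos : ∀ t, 0 < t → 0 < σ t)
    (k : ℕ) (hk : 1 ≤ k)
    (ts : Fin (k + 1) → ℝ) (hts : StrictMono ts)
    (δ : ℝ) (hδ : 0 < δ) (hts0 : ts 0 = δ) (htsk : ts (Fin.last k) = T)
    (ws : Fin k → ℝ)
    (ρ : ℝ → Fin M → ℝ) (hρcont : ContinuousOn ρ (Set.Icc δ T))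
    (hρsol : ∀ i : Fin k, ∀ τ ∈ Set.Ioo (ts i.castSucc) (ts i.succ),
      HasDerivAt ρ (-((guidedRateNor m p q σ (ws i) τ).mulVec (ρ τ))) τ) :
    (∀ i : Fin k,
      ρ (ts i.castSucc) m = ρ (ts i.succ) m *
        ((1 - Real.exp (-(sigmaBar σ (ts i.castSucc)))) /
          (1 - Real.exp (-(sigmaBar σ (ts i.succ)))))) ∧
    (∀ j, j ≠ m →
      ρ δ j = ρ T j + ∑ i : Fin k,
        ρ (ts i.succ) m *
          (1 - (1 - Real.exp (-(sigmaBar σ (ts i.castSucc)))) /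
            (1 - Real.exp (-(sigmaBar σ (ts i.succ))))) *
          tilted m p q (ws i) j) := by
  have hmem : ∀ i, ts i ∈ Set.Icc δ T := fun i =>
    ⟨hts0 ▸ hts.monotone (Fin.zero_le i), htsk ▸ hts.monotone (Fin.le_last i)⟩
  have hc : ∀ (i : Fin k) j, ContinuousOn (fun t => ρ t j)
      (Set.Icc (ts i.castSucc) (ts i.succ)) := fun i j =>
    ((continuous_apply j).comp_continuousOn hρcont).mono
      (Set.Icc_subset_Icc (hmem _).1 (hmem _).2)
  have hlt : ∀ i : Fin k, ts i.castSucc < ts i.succ := fun i => hts (Fin.castSucc_lt_succ)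
  have hd : ∀ (i : Fin k) j, ∀ τ ∈ Set.Ioo (ts i.castSucc) (ts i.succ),
      HasDerivAt (fun t => ρ t j)
        (-(cFun σ τ * (if j = m then -1 else tilted m p q (ws i) j) * ρ τ m)) τ := by
    intro i j τ hτ
    have := hasDerivAt_pi.1 (hρsol i τ hτ) j
    rwa [Pi.neg_apply, aux_mulVec] at this
  have H1 : ∀ i : Fin k,
      ρ (ts i.castSucc) m = ρ (ts i.succ) m *
        ((1 - Real.exp (-(sigmaBar σ (ts i.castSucc)))) /
          (1 - Real.exp (-(sigmaBar σ (ts i.succ))))) := by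
    intro i
    have hp : ∀ t ∈ Set.Icc (ts i.castSucc) (ts i.succ),
        0 < 1 - Real.exp (-(sigmaBar σ t)) := fun t ht =>
      aux_pos σ hσ hσpos t (lt_of_lt_of_le hδ ((hmem _).1.trans ht.1))
    have key := aux_const (fun t => ρ t m / (1 - Real.exp (-(sigmaBar σ t)))) _ _ (hlt i)
      ((hc i m).div (fun t _ => (aux_sb σ hσ t).continuousAt.continuousWithinAt)
        (fun t ht => (hp t ht).ne')) (by
        intro τ hτ
        have h0 := (hp τ (Set.Ioo_subset_Icc_self hτ)).ne'
        have := (hd i m τ hτ).div (aux_sb σ hσ τ) h0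
        refine this.congr_deriv ?_
        simp only [cFun, if_true]
        field_simp
        ring)
    have ha := (hp _ (Set.left_mem_Icc.2 (hlt i).le)).ne'
    have hb := (hp _ (Set.right_mem_Icc.2 (hlt i).le)).ne'
    beta_reduce at key
    rw [div_eq_iff ha] at key
    rw [key]
    ring
  refine ⟨H1, fun j hj => ?_⟩
  rw [← hts0, ← htsk]
  refine aux_sum k (fun i => ρ (ts i) j) _ fun i => ?_
  have key := aux_const (fun t => ρ t j + tilted m p q (ws i) j * ρ t m) _ _ (hlt i)
    ((hc i j).add (continuousOn_const.mul (hc i m))) (by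
      intro τ hτ
      have := (hd i j τ hτ).add ((hd i m τ hτ).const_mul (tilted m p q (ws i) j))
      refine this.congr_deriv ?_
      simp only [if_neg hj, if_true]
      ring)
  have h1 := H1 i
  beta_reduce at key ⊢
  linear_combination key - tilted m p q (ws i) j * h1
end

section
/- Let 0 < s < t ≤ T, fix a constant guidance strength w ∈ ℝ, and let ρ be a reverse-dynamics solution for the column-normalized family (R_nor^{(w)}_τ) on [s, t]. Then ρ s m = ρ t m · (1 − exp(−σ̄ s))/(1 − exp(−σ̄ t)), and for every i ≠ m, ρ s i = ρ t i + ρ t m · (1 − (1 − exp(−σ̄ s))/(1 − exp(−σ̄ t))) · p^{(w)} i. In particular the mask mass evolves exactly as in the unguided process, independently of w. -/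
open Finset

theorem const_aux (f : ℝ → ℝ) (s t : ℝ) (hst : s < t) (hc : ContinuousOn f (Set.Icc s t))
    (hd : ∀ x ∈ Set.Ioo s t, HasDerivAt f 0 x) : f s = f t := by
  obtain ⟨c, _, h⟩ := exists_hasDerivAt_eq_slope f (fun _ => 0) hst hc hd
  have h1 : t - s ≠ 0 := by linarith
  field_simp at h
  linarith

/-- Let `0 < s < t ≤ T`, fix a constant guidance strength `w ∈ ℝ`, and let
`ρ` be a reverse-dynamics solution for the column-normalized family `(R_nor^{(w)}_τ)` on
`[s, t]`.  Then `ρ s m = ρ t m · (1 - exp(-σ̄ s))/(1 - exp(-σ̄ t))`, and for every `i ≠ m`,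
`ρ s i = ρ t i + ρ t m · (1 - (1 - exp(-σ̄ s))/(1 - exp(-σ̄ t))) · p^{(w)} i`.  In particular
the mask mass evolves exactly as in the unguided process, independently of `w`. -/
theorem normalized_guided_reverse_dynamics_constant_guidance
    (M : ℕ) (hM : 2 ≤ M) (m : Fin M) (hm : (m : ℕ) = M - 1)
    (p q : Fin M → ℝ)
    (hp_nonneg : ∀ i, 0 ≤ p i) (hp_sum : ∑ i, p i = 1) (hpm : p m = 0)
    (hp_pos : ∀ i, i ≠ m → 0 < p i)
    (hq_nonneg : ∀ i, 0 ≤ q i) (hq_sum : ∑ i, q i = 1) (hqm : q m = 0)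
    (hq_pos : ∀ i, i ≠ m → 0 < q i)
    (T : ℝ) (hT : 0 < T)
    (σ : ℝ → ℝ) (hσ : Continuous σ) (hσpos : ∀ t, 0 < t → 0 < σ t)
    (w : ℝ) (s t : ℝ) (hs : 0 < s) (hst : s < t) (htT : t ≤ T)
    (ρ : ℝ → Fin M → ℝ)
    (hρ : IsReverseSol (fun τ => guidedRateNor m p q σ w τ) (Set.Icc s t) ρ) :
    ρ s m = ρ t m *
        ((1 - Real.exp (-(sigmaBar σ s))) / (1 - Real.exp (-(sigmaBar σ t)))) ∧
    ∀ i, i ≠ m →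
      ρ s i = ρ t i + ρ t m *
          (1 - (1 - Real.exp (-(sigmaBar σ s))) / (1 - Real.exp (-(sigmaBar σ t)))) *
          tilted m p q w i := by
  obtain ⟨hc, hd⟩ := hρ
  rw [interior_Icc] at hd
  have hcomp : ∀ i, ContinuousOn (fun τ => ρ τ i) (Set.Icc s t) := fun i =>
    (continuous_apply i).comp_continuousOn hc
  have hmv : ∀ τ i, ((guidedRateNor m p q σ w τ).mulVec (ρ τ)) i
      = cFun σ τ * (if i = m then -1 else tilted m p q w i) * ρ τ m := by
    intro τ i
    simp [Matrix.mulVec, dotProduct, guidedRateNor, Amat]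
  have hder : ∀ i, ∀ τ ∈ Set.Ioo s t, HasDerivAt (fun τ => ρ τ i)
      (-(cFun σ τ * (if i = m then -1 else tilted m p q w i) * ρ τ m)) τ := by
    intro i τ hτ
    have h := (hasDerivAt_pi.1 (hd τ hτ)) i
    rw [Pi.neg_apply, hmv] at h
    exact h
  have hσb : ∀ τ, HasDerivAt (sigmaBar σ) (σ τ) τ := fun τ =>
    intervalIntegral.integral_hasDerivAt_right (hσ.intervalIntegrable _ _)
      (hσ.stronglyMeasurableAtFilter _ _) hσ.continuousAt
  have hE : ∀ τ, HasDerivAt (fun τ => 1 - Real.exp (-(sigmaBar σ τ)))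
      (σ τ * Real.exp (-(sigmaBar σ τ))) τ := by
    intro τ
    have h := ((hσb τ).neg.exp).const_sub 1
    refine HasDerivAt.congr_deriv h ?_
    simp only [Pi.neg_apply]
    ring
  have hpos : ∀ τ, 0 < τ → 0 < 1 - Real.exp (-(sigmaBar σ τ)) := by
    intro τ hτ
    have : 0 < sigmaBar σ τ :=
      intervalIntegral.intervalIntegral_pos_of_pos_on (hσ.intervalIntegrable _ _)
        (fun x hx => hσpos x hx.1) hτ
    have h2 : Real.exp (-(sigmaBar σ τ)) < 1 := by rw [← Real.exp_zero]; exact Real.exp_lt_exp.2 (by linarith)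
    linarith
  have hEs := hpos s hs
  have hEt := hpos t (hs.trans hst)
  have h1 := const_aux (fun τ => ρ τ m / (1 - Real.exp (-(sigmaBar σ τ)))) s t hst
    ((hcomp m).div (fun τ _ => (hE τ).continuousAt.continuousWithinAt)
      (fun τ hτ => (hpos τ (hs.trans_le hτ.1)).ne'))
    (by
      intro τ hτ
      have hp := (hpos τ (hs.trans hτ.1)).ne'
      have h := (hder m τ hτ).div (hE τ) hp
      refine HasDerivAt.congr_deriv h ?_
      simp only [if_true, cFun]
      field_simp
      ring)
  have hm1 : ρ s m = ρ t m *
        ((1 - Real.exp (-(sigmaBar σ s))) / (1 - Real.exp (-(sigmaBar σ t)))) := by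
    have h1' : ρ s m / (1 - Real.exp (-(sigmaBar σ s)))
      = ρ t m / (1 - Real.exp (-(sigmaBar σ t))) := h1
    rw [div_eq_iff hEs.ne'] at h1'
    rw [h1']
    ring
  refine ⟨hm1, fun i hi => ?_⟩
  have h2 := const_aux (fun τ => ρ τ i + tilted m p q w i * ρ τ m) s t hst
    ((hcomp i).add (continuousOn_const.mul (hcomp m)))
    (by
      intro τ hτ
      have h := (hder i τ hτ).add ((hder m τ hτ).const_mul (tilted m p q w i))
      refine HasDerivAt.congr_deriv h ?_
      simp only [if_true, if_neg hi]
      ring)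
  have h2' : ρ s i + tilted m p q w i * ρ s m = ρ t i + tilted m p q w i * ρ t m := h2
  rw [hm1] at h2'
  linear_combination h2'
end
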